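/- (Proposition 2.) Let M ≥ 1, and for each j ∈ Fin M let a_j : ℕ → ℝ and D_j : ℕ → ℝ satisfy D_j(n) > 0 and a_j(n+1) = a_j(n) + D_j(n) for all n. Fix j₀ ∈ Fin M and issued-grant counts N : Fin M → ℕ, and let t = a_{j₀}(N(j₀)). Let T be a finite type of transmitters with card T ≥ M, and let χ be any function assigning to each issued grant (j, n), n < N(j), a transmitter χ(j, n) ∈ T. Then there exists a transmitter τ ∈ T such that no grant active at time t is assigned to τ; that is, if the total number of transmitters (summed over all sources) is at least the number of multipaths, a free transmitter is always available when a new grant starts, so transmitter blocking is avoided. -/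

import Mathlib

/-- The half-open intervals between consecutive values of a monotone sequence are disjoint. -/
theorem Monotone.eq_of_mem_Ico_succ {α : Type*} [Preorder α] {f : ℕ → α} (hf : Monotone f)
    {m n : ℕ} {t : α} (hm : t ∈ Set.Ico (f m) (f (m + 1)))
    (hn : t ∈ Set.Ico (f n) (f (n + 1))) : m = n := by
  have h₁ : m < n + 1 := hf.reflect_lt (hm.1.trans_lt hn.2)
  have h₂ : n < m + 1 := hf.reflect_lt (hn.1.trans_lt hm.2)
  omega

/-- Proposition 2: if the total number of transmitters is at least the number of
multipaths, then at the start time of any new grant some transmitter is free of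
all active grants, so transmitter blocking is avoided. -/
theorem no_transmitter_blocking
    (M : ℕ) (hM : 1 ≤ M)
    (a D : Fin M → ℕ → ℝ)
    (hD : ∀ j n, 0 < D j n)
    (hrec : ∀ j n, a j (n + 1) = a j n + D j n)
    (j₀ : Fin M) (N : Fin M → ℕ)
    (T : Type*) [Fintype T] (hT : M ≤ Fintype.card T)
    (χ : Fin M × ℕ → T) :
    ∃ τ : T, ∀ (j : Fin M) (n : ℕ), n < N j →
      a j₀ (N j₀) ∈ Set.Ico (a j n) (a j n + D j n) → χ (j, n) ≠ τ := by
  have hmono : ∀ j, Monotone (a j) := fun j =>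
    monotone_nat_of_le_succ fun n => by linarith [hD j n, hrec j n]
  simp only [← hrec]
  by_contra! h
  choose j n hn hact hχ using h
  have hinj : Function.Injective j := by
    intro τ τ' hj
    have h_act := hact τ
    rw [hj] at h_act
    have h_eq : n τ = n τ' := (hmono (j τ')).eq_of_mem_Ico_succ h_act (hact τ')
    rw [← hχ τ, ← hχ τ', hj, h_eq]
  have hne : j₀ ∉ Set.range j := by
    rintro ⟨τ, rfl⟩
    exact (hact τ).2.not_ge (hmono _ (hn τ))
  have hcard := Fintype.card_lt_of_injective_of_notMem j hinj hne
  rw [Fintype.card_fin] at hcard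
  omega
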